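/- Layer-splitting lemma for a three-user MAC: For a 3-user discrete memoryless MAC p(y|a,b,c) with independent inputs p = p(a)p(b)p(c), the region 𝓡_MAC(A,B,C;Y) equals ⋃_{p' ≃ p} ⋃_{λ=1}^{3} 𝓡(p',λ), where the three layer orders are λ=1: A₁→B₁→A₂→C→B₂, λ=2: B₁→C→A₁→B₂→A₂, λ=3: B₁→A₁→C→A₂→B₂. -/

import Mathlib

open scoped BigOperators Classical

noncomputable section

/-- Pushforward of a finitely supported weight function along a map. -/
def pushf {Ω β : Type*} [Fintype Ω] (q : Ω → ℝ) (f : Ω → β) : β → ℝ :=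
  fun b => ∑ ω, if f ω = b then q ω else 0

/-- Shannon entropy (in nats). -/
def ent {β : Type*} [Fintype β] (p : β → ℝ) : ℝ :=
  -∑ b, p b * Real.log (p b)

/-- Entropy of the random variable `A` under the joint pmf `q`. -/
def Hof {Ω β : Type*} [Fintype Ω] [Fintype β] (q : Ω → ℝ) (A : Ω → β) : ℝ :=
  ent (pushf q A)

/-- Mutual information `I(A;B)` under the joint pmf `q`. -/
def miOf {Ω α β : Type*} [Fintype Ω] [Fintype α] [Fintype β]
    (q : Ω → ℝ) (A : Ω → α) (B : Ω → β) : ℝ :=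
  Hof q A + Hof q B - Hof q (fun ω => (A ω, B ω))

/-- Conditional mutual information `I(A;B|C)` under the joint pmf `q`. -/
def cmiOf {Ω α β γ : Type*} [Fintype Ω] [Fintype α] [Fintype β] [Fintype γ]
    (q : Ω → ℝ) (A : Ω → α) (B : Ω → β) (C : Ω → γ) : ℝ :=
  Hof q (fun ω => (A ω, C ω)) + Hof q (fun ω => (B ω, C ω))
    - Hof q (fun ω => (A ω, B ω, C ω)) - Hof q C

/-- `p` is a probability mass function. -/
def IsPMF {α : Type*} [Fintype α] (p : α → ℝ) : Prop :=
  (∀ a, 0 ≤ p a) ∧ ∑ a, p a = 1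

/-- Joint pmf on `(A, B, C, Y)` for a three-user MAC with independent inputs. -/
def macJoint {𝒜 ℬ 𝒞 𝒴 : Type} (pA : 𝒜 → ℝ) (pB : ℬ → ℝ) (pC : 𝒞 → ℝ)
    (ch : 𝒜 → ℬ → 𝒞 → 𝒴 → ℝ) : 𝒜 × ℬ × 𝒞 × 𝒴 → ℝ :=
  fun ω => pA ω.1 * pB ω.2.1 * pC ω.2.2.1 * ch ω.1 ω.2.1 ω.2.2.1 ω.2.2.2

/-- The standard three-user MAC region `𝓡_MAC(A,B,C;Y)` (seven inequalities). -/
def RMAC {𝒜 ℬ 𝒞 𝒴 : Type} [Fintype 𝒜] [Fintype ℬ] [Fintype 𝒞] [Fintype 𝒴]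
    (pA : 𝒜 → ℝ) (pB : ℬ → ℝ) (pC : 𝒞 → ℝ)
    (ch : 𝒜 → ℬ → 𝒞 → 𝒴 → ℝ) : Set (ℝ × ℝ × ℝ) :=
  {r | 0 ≤ r.1 ∧ 0 ≤ r.2.1 ∧ 0 ≤ r.2.2 ∧
    r.1 ≤ cmiOf (macJoint pA pB pC ch) (fun ω => ω.1) (fun ω => ω.2.2.2)
      (fun ω => (ω.2.1, ω.2.2.1)) ∧
    r.2.1 ≤ cmiOf (macJoint pA pB pC ch) (fun ω => ω.2.1) (fun ω => ω.2.2.2)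
      (fun ω => (ω.1, ω.2.2.1)) ∧
    r.2.2 ≤ cmiOf (macJoint pA pB pC ch) (fun ω => ω.2.2.1) (fun ω => ω.2.2.2)
      (fun ω => (ω.1, ω.2.1)) ∧
    r.1 + r.2.1 ≤ cmiOf (macJoint pA pB pC ch) (fun ω => (ω.1, ω.2.1)) (fun ω => ω.2.2.2)
      (fun ω => ω.2.2.1) ∧
    r.1 + r.2.2 ≤ cmiOf (macJoint pA pB pC ch) (fun ω => (ω.1, ω.2.2.1)) (fun ω => ω.2.2.2)
      (fun ω => ω.2.1) ∧
    r.2.1 + r.2.2 ≤ cmiOf (macJoint pA pB pC ch) (fun ω => (ω.2.1, ω.2.2.1))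
      (fun ω => ω.2.2.2) (fun ω => ω.1) ∧
    r.1 + r.2.1 + r.2.2 ≤ miOf (macJoint pA pB pC ch) (fun ω => (ω.1, ω.2.1, ω.2.2.1))
      (fun ω => ω.2.2.2)}

/-- A split distribution for the three-user MAC: `A` and `B` are split into two
independent layers each, `C` is unsplit. -/
structure MacSplit (𝒜 ℬ 𝒞 : Type) [Fintype 𝒜] [Fintype ℬ] [Fintype 𝒞] where
  A1 : Type
  A2 : Type
  B1 : Type
  B2 : Type
  [finA1 : Fintype A1]
  [finA2 : Fintype A2]
  [finB1 : Fintype B1]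
  [finB2 : Fintype B2]
  pa1 : A1 → ℝ
  pa2 : A2 → ℝ
  pb1 : B1 → ℝ
  pb2 : B2 → ℝ
  pc : 𝒞 → ℝ
  fa : A1 → A2 → 𝒜
  fb : B1 → B2 → ℬ
  pa1_pmf : IsPMF pa1
  pa2_pmf : IsPMF pa2
  pb1_pmf : IsPMF pb1
  pb2_pmf : IsPMF pb2
  pc_pmf : IsPMF pc

attribute [instance] MacSplit.finA1 MacSplit.finA2 MacSplit.finB1 MacSplit.finB2

/-- `p' ≃ p`: `A = fa(A₁,A₂) ~ pA`, `B = fb(B₁,B₂) ~ pB`, `C ~ pC`. -/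
def MacSplit.Matches {𝒜 ℬ 𝒞 : Type} [Fintype 𝒜] [Fintype ℬ] [Fintype 𝒞]
    (s : MacSplit 𝒜 ℬ 𝒞) (pA : 𝒜 → ℝ) (pB : ℬ → ℝ) (pC : 𝒞 → ℝ) : Prop :=
  (∀ a, pushf (fun x : s.A1 × s.A2 => s.pa1 x.1 * s.pa2 x.2) (fun x => s.fa x.1 x.2) a = pA a) ∧
  (∀ b, pushf (fun x : s.B1 × s.B2 => s.pb1 x.1 * s.pb2 x.2) (fun x => s.fb x.1 x.2) b = pB b) ∧
  s.pc = pC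

/-- Joint pmf on `(A₁, A₂, B₁, B₂, C, Y)` induced by a MAC split and the channel. -/
def macSplitJoint {𝒜 ℬ 𝒞 𝒴 : Type} [Fintype 𝒜] [Fintype ℬ] [Fintype 𝒞]
    (s : MacSplit 𝒜 ℬ 𝒞) (ch : 𝒜 → ℬ → 𝒞 → 𝒴 → ℝ) :
    s.A1 × s.A2 × s.B1 × s.B2 × 𝒞 × 𝒴 → ℝ :=
  fun ω => s.pa1 ω.1 * s.pa2 ω.2.1 * s.pb1 ω.2.2.1 * s.pb2 ω.2.2.2.1 * s.pc ω.2.2.2.2.1 *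
    ch (s.fa ω.1 ω.2.1) (s.fb ω.2.2.1 ω.2.2.2.1) ω.2.2.2.2.1 ω.2.2.2.2.2

variable {𝒜 ℬ 𝒞 𝒴 : Type} [Fintype 𝒜] [Fintype ℬ] [Fintype 𝒞] [Fintype 𝒴]

/-- Successive-cancellation region for layer order `λ = 1 : A₁→B₁→A₂→C→B₂`. -/
def RMacSplit1 (s : MacSplit 𝒜 ℬ 𝒞) (ch : 𝒜 → ℬ → 𝒞 → 𝒴 → ℝ) : Set (ℝ × ℝ × ℝ) :=
  {r | 0 ≤ r.1 ∧ 0 ≤ r.2.1 ∧ 0 ≤ r.2.2 ∧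
    r.1 ≤ miOf (macSplitJoint s ch) (fun ω => ω.1) (fun ω => ω.2.2.2.2.2)
        + cmiOf (macSplitJoint s ch) (fun ω => ω.2.1) (fun ω => ω.2.2.2.2.2)
            (fun ω => (ω.1, ω.2.2.1)) ∧
    r.2.1 ≤ cmiOf (macSplitJoint s ch) (fun ω => ω.2.2.1) (fun ω => ω.2.2.2.2.2)
          (fun ω => ω.1)
        + cmiOf (macSplitJoint s ch) (fun ω => ω.2.2.2.1) (fun ω => ω.2.2.2.2.2)
            (fun ω => (ω.1, ω.2.2.1, ω.2.1, ω.2.2.2.2.1)) ∧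
    r.2.2 ≤ cmiOf (macSplitJoint s ch) (fun ω => ω.2.2.2.2.1) (fun ω => ω.2.2.2.2.2)
          (fun ω => (ω.1, ω.2.2.1, ω.2.1))}

/-- Successive-cancellation region for layer order `λ = 2 : B₁→C→A₁→B₂→A₂`. -/
def RMacSplit2 (s : MacSplit 𝒜 ℬ 𝒞) (ch : 𝒜 → ℬ → 𝒞 → 𝒴 → ℝ) : Set (ℝ × ℝ × ℝ) :=
  {r | 0 ≤ r.1 ∧ 0 ≤ r.2.1 ∧ 0 ≤ r.2.2 ∧
    r.1 ≤ cmiOf (macSplitJoint s ch) (fun ω => ω.1) (fun ω => ω.2.2.2.2.2)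
          (fun ω => (ω.2.2.1, ω.2.2.2.2.1))
        + cmiOf (macSplitJoint s ch) (fun ω => ω.2.1) (fun ω => ω.2.2.2.2.2)
            (fun ω => (ω.2.2.1, ω.2.2.2.2.1, ω.1, ω.2.2.2.1)) ∧
    r.2.1 ≤ miOf (macSplitJoint s ch) (fun ω => ω.2.2.1) (fun ω => ω.2.2.2.2.2)
        + cmiOf (macSplitJoint s ch) (fun ω => ω.2.2.2.1) (fun ω => ω.2.2.2.2.2)
            (fun ω => (ω.2.2.1, ω.2.2.2.2.1, ω.1)) ∧
    r.2.2 ≤ cmiOf (macSplitJoint s ch) (fun ω => ω.2.2.2.2.1) (fun ω => ω.2.2.2.2.2)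
          (fun ω => ω.2.2.1)}

/-- Successive-cancellation region for layer order `λ = 3 : B₁→A₁→C→A₂→B₂`. -/
def RMacSplit3 (s : MacSplit 𝒜 ℬ 𝒞) (ch : 𝒜 → ℬ → 𝒞 → 𝒴 → ℝ) : Set (ℝ × ℝ × ℝ) :=
  {r | 0 ≤ r.1 ∧ 0 ≤ r.2.1 ∧ 0 ≤ r.2.2 ∧
    r.1 ≤ cmiOf (macSplitJoint s ch) (fun ω => ω.1) (fun ω => ω.2.2.2.2.2)
          (fun ω => ω.2.2.1)
        + cmiOf (macSplitJoint s ch) (fun ω => ω.2.1) (fun ω => ω.2.2.2.2.2)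
            (fun ω => (ω.2.2.1, ω.1, ω.2.2.2.2.1)) ∧
    r.2.1 ≤ miOf (macSplitJoint s ch) (fun ω => ω.2.2.1) (fun ω => ω.2.2.2.2.2)
        + cmiOf (macSplitJoint s ch) (fun ω => ω.2.2.2.1) (fun ω => ω.2.2.2.2.2)
            (fun ω => (ω.2.2.1, ω.1, ω.2.2.2.2.1, ω.2.1)) ∧
    r.2.2 ≤ cmiOf (macSplitJoint s ch) (fun ω => ω.2.2.2.2.1) (fun ω => ω.2.2.2.2.2)
          (fun ω => (ω.2.2.1, ω.1))}

section Entropy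

variable {Ω β γ δ : Type*} [Fintype Ω] [Fintype β] [Fintype γ] [Fintype δ]

theorem Hof_eq_sum (q : Ω → ℝ) (A : Ω → β) :
    Hof q A = -∑ ω, q ω * Real.log (pushf q A (A ω)) := by
  unfold Hof ent
  congr 1
  calc ∑ b, pushf q A b * Real.log (pushf q A b)
      = ∑ b, ∑ ω, if A ω = b then q ω * Real.log (pushf q A b) else 0 := by
        refine Finset.sum_congr rfl fun b _ => ?_
        conv_lhs => enter [1]; rw [pushf]
        rw [Finset.sum_mul]
        refine Finset.sum_congr rfl fun ω _ => ?_
        split_ifs <;> simp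
    _ = _ := by
        rw [Finset.sum_comm]
        simp

/-- The entropy of a random variable depends only on the partition it induces. -/
theorem Hof_congr (q : Ω → ℝ) {A : Ω → β} {B : Ω → γ}
    (h : ∀ ω ω', A ω = A ω' ↔ B ω = B ω') : Hof q A = Hof q B := by
  simp only [Hof_eq_sum, pushf, h]

theorem Hof_const (q : Ω → ℝ) (hq : ∑ ω, q ω = 1) : Hof q (fun _ => ()) = 0 := by
  simp [Hof_eq_sum, pushf, hq]

/-- The conditional entropy `H(Y|X)` under the joint pmf `q`. -/
def condHof (q : Ω → ℝ) (X : Ω → β) (Y : Ω → γ) : ℝ :=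
  Hof q (fun ω => (X ω, Y ω)) - Hof q X

theorem condHof_congr (q : Ω → ℝ) {A : Ω → β} {B : Ω → γ} (Y : Ω → δ)
    (h : ∀ ω ω', A ω = A ω' ↔ B ω = B ω') : condHof q A Y = condHof q B Y := by
  unfold condHof
  rw [Hof_congr q h, Hof_congr q (A := fun ω => (A ω, Y ω)) (B := fun ω => (B ω, Y ω))]
  simp [h]

theorem cmiOf_eq_condHof (q : Ω → ℝ) (A : Ω → β) (Y : Ω → γ) (C : Ω → δ) :
    cmiOf q A Y C = condHof q C Y - condHof q (fun ω => (A ω, C ω)) Y := by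
  unfold cmiOf condHof
  rw [Hof_congr q (A := fun ω => (Y ω, C ω)) (B := fun ω => (C ω, Y ω)) (by simp; tauto),
    Hof_congr q (A := fun ω => (A ω, Y ω, C ω)) (B := fun ω => ((A ω, C ω), Y ω))
      (by simp; tauto)]
  ring

theorem miOf_eq_condHof (q : Ω → ℝ) (hq : ∑ ω, q ω = 1) (A : Ω → β) (Y : Ω → γ) :
    miOf q A Y = condHof q (fun _ => ()) Y - condHof q A Y := by
  unfold miOf condHof
  rw [Hof_const q hq, Hof_congr q (A := fun ω => ((), Y ω)) (B := Y) (by simp)]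
  ring

theorem ent_eq_sum_negMulLog (p : β → ℝ) : ent p = ∑ b, Real.negMulLog (p b) := by
  simp [ent, Real.negMulLog]

theorem condHof_eq_sum (q : Ω → ℝ) (X : Ω → β) (Y : Ω → γ) (P : β → ℝ) (W : β → γ → ℝ)
    (hq : ∀ x y, pushf q (fun ω => (X ω, Y ω)) (x, y) = P x * W x y)
    (hW : ∀ x, ∑ y, W x y = 1) :
    condHof q X Y = ∑ x, P x * ∑ y, Real.negMulLog (W x y) := by
  have hX : ∀ x, pushf q X x = P x := fun x => by
    have : ∑ y, pushf q (fun ω => (X ω, Y ω)) (x, y) = pushf q X x := by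
      unfold pushf
      rw [Finset.sum_comm]
      refine Finset.sum_congr rfl fun ω _ => ?_
      by_cases h : X ω = x <;> simp [h]
    rw [← this]
    simp_rw [hq, ← Finset.mul_sum, hW, mul_one]
  unfold condHof Hof
  rw [ent_eq_sum_negMulLog, ent_eq_sum_negMulLog, Fintype.sum_prod_type, ← Finset.sum_sub_distrib]
  refine Finset.sum_congr rfl fun x _ => ?_
  simp_rw [hq, hX, Real.negMulLog_mul, Finset.sum_add_distrib, ← Finset.sum_mul, hW,
    ← Finset.mul_sum]
  ring

end Entropy

/-- Submodularity of the averaged entropy under independent refinements of two inputs. -/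
theorem sum_negMulLog_submodular {U U' V V' : Type*} [Fintype U] [Fintype U'] [Fintype V]
    [Fintype V'] (π : U → ℝ) (π' : U' → ℝ) (σ : V → ℝ) (σ' : V' → ℝ)
    (ρ : U → U' → ℝ) (τ : V → V' → ℝ)
    (W : U → V → ℝ) (W₁ : U' → V → ℝ) (W₂ : U → V' → ℝ) (W₁₂ : U' → V' → ℝ)
    (hπ : ∀ u, 0 ≤ π u) (hσ : ∀ v, 0 ≤ σ v) (hρ : ∀ u u', 0 ≤ ρ u u') (hτ : ∀ v v', 0 ≤ τ v v')
    (hπ' : ∀ u', π' u' = ∑ u, π u * ρ u u') (hσ' : ∀ v', σ' v' = ∑ v, σ v * τ v v')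
    (hW : ∀ u' v', 0 ≤ W₁₂ u' v')
    (h₁ : ∀ u v, W u v = ∑ u', ρ u u' * W₁ u' v)
    (h₂ : ∀ u v, W u v = ∑ v', τ v v' * W₂ u v')
    (h₁₂ : ∀ u' v, W₁ u' v = ∑ v', τ v v' * W₁₂ u' v')
    (h₂₁ : ∀ u v', W₂ u v' = ∑ u', ρ u u' * W₁₂ u' v') :
    (∑ u, ∑ v, π u * σ v * Real.negMulLog (W u v))
      + ∑ u', ∑ v', π' u' * σ' v' * Real.negMulLog (W₁₂ u' v')
    ≤ (∑ u, ∑ v', π u * σ' v' * Real.negMulLog (W₂ u v'))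
      + ∑ u', ∑ v, π' u' * σ v * Real.negMulLog (W₁ u' v) := by
  have e₀ : ∀ F : U → V → ℝ, ∑ u, ∑ v, π u * σ v * (W u v * F u v)
      = ∑ u, ∑ v, ∑ u', ∑ v', π u * ρ u u' * σ v * τ v v' * (W₁₂ u' v' * F u v) := by
    intro F
    refine Finset.sum_congr rfl fun u _ => Finset.sum_congr rfl fun v _ => ?_
    simp_rw [h₁, h₁₂, Finset.mul_sum, Finset.sum_mul, Finset.mul_sum]
    refine Finset.sum_congr rfl fun _ _ => Finset.sum_congr rfl fun _ _ => ?_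
    ring
  have e₁ : ∀ F : U' → V → ℝ, ∑ u', ∑ v, π' u' * σ v * (W₁ u' v * F u' v)
      = ∑ u, ∑ v, ∑ u', ∑ v', π u * ρ u u' * σ v * τ v v' * (W₁₂ u' v' * F u' v) := by
    intro F
    simp_rw [hπ', h₁₂, Finset.sum_mul, Finset.mul_sum]
    calc _ = ∑ u', ∑ u, ∑ v, ∑ v', _ := Finset.sum_congr rfl fun _ _ => Finset.sum_comm
      _ = ∑ u, ∑ u', ∑ v, ∑ v', _ := Finset.sum_comm
      _ = ∑ u, ∑ v, ∑ u', ∑ v', _ := Finset.sum_congr rfl fun _ _ => Finset.sum_comm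
      _ = _ := by
          refine Finset.sum_congr rfl fun _ _ => Finset.sum_congr rfl fun _ _ =>
            Finset.sum_congr rfl fun _ _ => Finset.sum_congr rfl fun _ _ => ?_
          ring
  have e₂ : ∀ F : U → V' → ℝ, ∑ u, ∑ v', π u * σ' v' * (W₂ u v' * F u v')
      = ∑ u, ∑ v, ∑ u', ∑ v', π u * ρ u u' * σ v * τ v v' * (W₁₂ u' v' * F u v') := by
    intro F
    refine Finset.sum_congr rfl fun u _ => ?_
    simp_rw [hσ', h₂₁, Finset.mul_sum, Finset.sum_mul, Finset.mul_sum]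
    calc _ = ∑ v, ∑ v', ∑ u', _ := Finset.sum_comm
      _ = ∑ v, ∑ u', ∑ v', _ := Finset.sum_congr rfl fun _ _ => Finset.sum_comm
      _ = _ := by
          refine Finset.sum_congr rfl fun _ _ =>
            Finset.sum_congr rfl fun _ _ => Finset.sum_congr rfl fun _ _ => ?_
          ring
  have e₁₂ : ∀ F : U' → V' → ℝ, ∑ u', ∑ v', π' u' * σ' v' * F u' v'
      = ∑ u, ∑ v, ∑ u', ∑ v', π u * ρ u u' * σ v * τ v v' * F u' v' := by
    intro F
    simp_rw [hπ', hσ', Finset.sum_mul_sum, Finset.sum_mul]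
    calc _ = ∑ u', ∑ u, ∑ v', ∑ v, _ := Finset.sum_congr rfl fun _ _ => Finset.sum_comm
      _ = ∑ u, ∑ u', ∑ v', ∑ v, _ := Finset.sum_comm
      _ = ∑ u, ∑ u', ∑ v, ∑ v', _ := Finset.sum_congr rfl fun _ _ =>
          Finset.sum_congr rfl fun _ _ => Finset.sum_comm
      _ = ∑ u, ∑ v, ∑ u', ∑ v', _ := Finset.sum_congr rfl fun _ _ => Finset.sum_comm
      _ = _ := by
          refine Finset.sum_congr rfl fun _ _ => Finset.sum_congr rfl fun _ _ =>
            Finset.sum_congr rfl fun _ _ => Finset.sum_congr rfl fun _ _ => ?_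
          ring
  have hW₁ : ∀ u' v, 0 ≤ W₁ u' v := fun u' v => by
    rw [h₁₂]; exact Finset.sum_nonneg fun v' _ => mul_nonneg (hτ v v') (hW u' v')
  have hW₂ : ∀ u v', 0 ≤ W₂ u v' := fun u v' => by
    rw [h₂₁]; exact Finset.sum_nonneg fun u' _ => mul_nonneg (hρ u u') (hW u' v')
  have hW₀ : ∀ u v, 0 ≤ W u v := fun u v => by
    rw [h₁]; exact Finset.sum_nonneg fun u' _ => mul_nonneg (hρ u u') (hW₁ u' v)
  have term : ∀ u v u' v', π u * ρ u u' * σ v * τ v v' * (W₁₂ u' v' *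
      (Real.log (W₂ u v') + Real.log (W₁ u' v) - Real.log (W u v) - Real.log (W₁₂ u' v')))
      ≤ π u * ρ u u' * σ v * τ v v' * (W₂ u v' * W₁ u' v / W u v - W₁₂ u' v') := by
    intro u v u' v'
    rcases (hρ u u').eq_or_lt with h | hρ0
    · simp [← h]
    rcases (hτ v v').eq_or_lt with h | hτ0
    · simp [← h]
    have hT : 0 ≤ π u * ρ u u' * σ v * τ v v' :=
      mul_nonneg (mul_nonneg (mul_nonneg (hπ u) (hρ u u')) (hσ v)) (hτ v v')
    refine mul_le_mul_of_nonneg_left ?_ hT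
    rcases (hW u' v').eq_or_lt with h | h0
    · rw [← h, zero_mul, sub_zero]
      exact div_nonneg (mul_nonneg (hW₂ u v') (hW₁ u' v)) (hW₀ u v)
    have p₁ : 0 < W₁ u' v := by
      rw [h₁₂]
      exact Finset.sum_pos' (fun i _ => mul_nonneg (hτ v i) (hW u' i))
        ⟨v', Finset.mem_univ _, mul_pos hτ0 h0⟩
    have p₂ : 0 < W₂ u v' := by
      rw [h₂₁]
      exact Finset.sum_pos' (fun i _ => mul_nonneg (hρ u i) (hW i v'))
        ⟨u', Finset.mem_univ _, mul_pos hρ0 h0⟩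
    have p₀ : 0 < W u v := by
      rw [h₁]
      exact Finset.sum_pos' (fun i _ => mul_nonneg (hρ u i) (hW₁ i v))
        ⟨u', Finset.mem_univ _, mul_pos hρ0 p₁⟩
    have hl := Real.log_le_sub_one_of_pos
      (div_pos (div_pos (mul_pos p₂ p₁) p₀) h0)
    rw [Real.log_div (div_pos (mul_pos p₂ p₁) p₀).ne' h0.ne',
      Real.log_div (mul_pos p₂ p₁).ne' p₀.ne', Real.log_mul p₂.ne' p₁.ne'] at hl
    calc _ ≤ W₁₂ u' v' * (W₂ u v' * W₁ u' v / W u v / W₁₂ u' v' - 1) :=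
          mul_le_mul_of_nonneg_left hl h0.le
      _ = _ := by field_simp
  have total : ∑ u, ∑ v, ∑ u', ∑ v',
      π u * ρ u u' * σ v * τ v v' * (W₂ u v' * W₁ u' v / W u v - W₁₂ u' v') = 0 := by
    have ha := e₀ (fun _ _ => 1)
    simp only [mul_one] at ha
    simp_rw [mul_sub, Finset.sum_sub_distrib, ← ha, ← Finset.sum_sub_distrib]
    refine Finset.sum_eq_zero fun u _ => Finset.sum_eq_zero fun v _ => ?_
    have hb : ∑ u', ∑ v', π u * ρ u u' * σ v * τ v v' * (W₂ u v' * W₁ u' v / W u v)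
        = π u * σ v * ((∑ u', ρ u u' * W₁ u' v) * (∑ v', τ v v' * W₂ u v') / W u v) := by
      rw [Finset.sum_mul_sum, Finset.sum_div, Finset.mul_sum]
      refine Finset.sum_congr rfl fun u' _ => ?_
      rw [Finset.sum_div, Finset.mul_sum]
      refine Finset.sum_congr rfl fun v' _ => ?_
      ring
    rw [hb, ← h₁, ← h₂, mul_self_div_self, sub_self]
  have key := Finset.sum_le_sum fun u (_ : u ∈ Finset.univ) =>
    Finset.sum_le_sum fun v (_ : v ∈ Finset.univ) =>
    Finset.sum_le_sum fun u' (_ : u' ∈ Finset.univ) =>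
    Finset.sum_le_sum fun v' (_ : v' ∈ Finset.univ) => term u v u' v'
  rw [total] at key
  have f₀ := e₀ fun u v => Real.log (W u v)
  have f₁ := e₁ fun u v => Real.log (W₁ u v)
  have f₂ := e₂ fun u v => Real.log (W₂ u v)
  have f₁₂ := e₁₂ fun u v => W₁₂ u v * Real.log (W₁₂ u v)
  simp only [mul_sub, mul_add, Finset.sum_sub_distrib, Finset.sum_add_distrib] at key
  simp only [Real.negMulLog, neg_mul, mul_neg, Finset.sum_neg_distrib]
  linarith

/-- A partial observation of a random variable on `α`: an observation with law `π`, and the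
conditional law `κ u` of the variable given the observation `u`. -/
structure View (U α : Type) [Fintype α] where
  π : U → ℝ
  κ : U → α → ℝ
  π_nonneg : ∀ u, 0 ≤ π u
  κ_nonneg : ∀ u a, 0 ≤ κ u a
  sum_κ : ∀ u, ∑ a, κ u a = 1

namespace View

section OneUser

variable {α U V X X₁ X₂ : Type} [Fintype α] [Fintype X] [Fintype X₁] [Fintype X₂]

/-- Conditional expectation given the observation. -/
def E (P : View U α) (u : U) (φ : α → ℝ) : ℝ := ∑ a, P.κ u a * φ a

theorem E_nonneg (P : View U α) (u : U) {φ : α → ℝ} (h : ∀ a, 0 ≤ φ a) : 0 ≤ P.E u φ :=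
  Finset.sum_nonneg fun a _ => mul_nonneg (P.κ_nonneg u a) (h a)

theorem E_one (P : View U α) (u : U) : P.E u (fun _ => 1) = 1 := by
  simp [E, P.sum_κ]

theorem E_sum {ι : Type} [Fintype ι] (P : View U α) (u : U) (φ : ι → α → ℝ) :
    P.E u (fun a => ∑ i, φ i a) = ∑ i, P.E u (φ i) := by
  simp only [E, Finset.mul_sum]
  exact Finset.sum_comm

theorem E_mul_left (P : View U α) (u : U) (k : ℝ) (φ : α → ℝ) :
    P.E u (fun a => k * φ a) = k * P.E u φ := by
  simp only [E, Finset.mul_sum]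
  exact Finset.sum_congr rfl fun a _ => by ring

theorem E_comm {β : Type} [Fintype β] (P : View U α) (Q : View V β) (u : U) (v : V)
    (φ : α → β → ℝ) :
    P.E u (fun a => Q.E v (φ a)) = Q.E v (fun b => P.E u (fun a => φ a b)) := by
  simp only [E, Finset.mul_sum]
  rw [Finset.sum_comm]
  exact Finset.sum_congr rfl fun b _ => Finset.sum_congr rfl fun a _ => by ring

theorem E_eq_sum_E [Fintype V] {P : View U α} {Q : View V α} {ρ : U → V → ℝ}
    (h : ∀ u a, P.κ u a = ∑ u', ρ u u' * Q.κ u' a) (u : U) (φ : α → ℝ) :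
    P.E u φ = ∑ u', ρ u u' * Q.E u' φ := by
  simp only [E, h, Finset.sum_mul, Finset.mul_sum]
  rw [Finset.sum_comm]
  exact Finset.sum_congr rfl fun _ _ => Finset.sum_congr rfl fun _ _ => by ring

variable [Fintype U] [Fintype V]

/-- The variable viewed through `P` has law `p`. -/
def Of (P : View U α) (p : α → ℝ) : Prop := ∀ a, ∑ u, P.π u * P.κ u a = p a

/-- The observation `P` is a degraded version of the observation `Q`. -/
def Coarser (P : View U α) (Q : View V α) : Prop :=
  ∃ ρ : U → V → ℝ, (∀ u u', 0 ≤ ρ u u') ∧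
    (∀ u a, P.κ u a = ∑ u', ρ u u' * Q.κ u' a) ∧ ∀ u', Q.π u' = ∑ u, P.π u * ρ u u'

/-- For `x` distributed as `p`, `P` is the observation of `f x` through `g x`. -/
def Observes (P : View U α) (p : X → ℝ) (f : X → α) (g : X → U) : Prop :=
  ∀ u φ, P.π u * P.E u φ = ∑ x, if g x = u then p x * φ (f x) else 0

/-- The view that observes nothing. -/
def triv (p : α → ℝ) (hp : IsPMF p) : View Unit α where
  π _ := 1
  κ _ := p
  π_nonneg _ := zero_le_one
  κ_nonneg _ := hp.1
  sum_κ _ := hp.2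

/-- The view that observes everything. -/
def full (p : α → ℝ) (hp : IsPMF p) : View α α where
  π := p
  κ u a := if u = a then 1 else 0
  π_nonneg := hp.1
  κ_nonneg u a := by split_ifs <;> norm_num
  sum_κ u := by simp

/-- The view of `f x₁ x₂` through its first layer `x₁`. -/
def layer (p₁ : X₁ → ℝ) (p₂ : X₂ → ℝ) (h₁ : IsPMF p₁) (h₂ : IsPMF p₂) (f : X₁ → X₂ → α) :
    View X₁ α where
  π := p₁
  κ u a := ∑ x, if f u x = a then p₂ x else 0
  π_nonneg := h₁.1
  κ_nonneg u a := Finset.sum_nonneg fun x _ => by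
    split_ifs
    exacts [h₂.1 x, le_rfl]
  sum_κ u := by
    rw [Finset.sum_comm]
    simp [h₂.2]

/-- The view of `f x₁ x₂` through both layers. -/
def both (p₁ : X₁ → ℝ) (p₂ : X₂ → ℝ) (h₁ : IsPMF p₁) (h₂ : IsPMF p₂) (f : X₁ → X₂ → α) :
    View (X₁ × X₂) α where
  π x := p₁ x.1 * p₂ x.2
  κ x a := if f x.1 x.2 = a then 1 else 0
  π_nonneg x := mul_nonneg (h₁.1 _) (h₂.1 _)
  κ_nonneg u a := by split_ifs <;> norm_num
  sum_κ u := by simp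

theorem E_triv (p : α → ℝ) (hp : IsPMF p) (u : Unit) (φ : α → ℝ) :
    (triv p hp).E u φ = ∑ a, p a * φ a := rfl

theorem E_full (p : α → ℝ) (hp : IsPMF p) (u : α) (φ : α → ℝ) :
    (full p hp).E u φ = φ u := by
  simp [E, full]

theorem E_layer (p₁ : X₁ → ℝ) (p₂ : X₂ → ℝ) (h₁ : IsPMF p₁) (h₂ : IsPMF p₂)
    (f : X₁ → X₂ → α) (u : X₁) (φ : α → ℝ) :
    (layer p₁ p₂ h₁ h₂ f).E u φ = ∑ x, p₂ x * φ (f u x) := by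
  simp only [E, layer, Finset.sum_mul]
  rw [Finset.sum_comm]
  simp

theorem E_both (p₁ : X₁ → ℝ) (p₂ : X₂ → ℝ) (h₁ : IsPMF p₁) (h₂ : IsPMF p₂)
    (f : X₁ → X₂ → α) (u : X₁ × X₂) (φ : α → ℝ) :
    (both p₁ p₂ h₁ h₂ f).E u φ = φ (f u.1 u.2) := by
  simp [E, both]

theorem full_of (p : α → ℝ) (hp : IsPMF p) : (full p hp).Of p := fun a => by simp [full]

theorem triv_coarser {P : View U α} {p : α → ℝ} (hp : IsPMF p) (h : P.Of p) :
    (triv p hp).Coarser P :=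
  ⟨fun _ u => P.π u, fun _ => P.π_nonneg, fun _ a => (h a).symm, fun _ => by simp [triv]⟩

theorem coarser_full {P : View U α} {p : α → ℝ} (hp : IsPMF p) (h : P.Of p) :
    P.Coarser (full p hp) :=
  ⟨P.κ, P.κ_nonneg, fun u a => by simp [full], fun a => (h a).symm⟩

/-- `f x₁ x₂` has law `p` when the two layers are independent with laws `p₁`, `p₂`. -/
theorem sum_mul_eq_of_pushf {p : α → ℝ} {p₁ : X₁ → ℝ} {p₂ : X₂ → ℝ} {f : X₁ → X₂ → α}
    (h : ∀ a, pushf (fun x : X₁ × X₂ => p₁ x.1 * p₂ x.2) (fun x => f x.1 x.2) a = p a)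
    (φ : α → ℝ) : ∑ a, p a * φ a = ∑ x : X₁ × X₂, p₁ x.1 * p₂ x.2 * φ (f x.1 x.2) := by
  simp only [← h, pushf, Finset.sum_mul]
  rw [Finset.sum_comm]
  simp

theorem layer_of {p : α → ℝ} {p₁ : X₁ → ℝ} {p₂ : X₂ → ℝ} (h₁ : IsPMF p₁) (h₂ : IsPMF p₂)
    {f : X₁ → X₂ → α}
    (h : ∀ a, pushf (fun x : X₁ × X₂ => p₁ x.1 * p₂ x.2) (fun x => f x.1 x.2) a = p a) :
    (layer p₁ p₂ h₁ h₂ f).Of p := fun a => by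
  simp [← h, pushf, Fintype.sum_prod_type, layer, Finset.mul_sum]

theorem triv_observes {p : α → ℝ} (hp : IsPMF p) :
    (triv p hp).Observes p id (fun _ => ()) := fun u φ => by
  rw [E_triv]
  simp [triv]

theorem full_observes {p : α → ℝ} (hp : IsPMF p) : (full p hp).Observes p id id := fun u φ => by
  rw [E_full]
  simp [full]

theorem triv_observes_layers {p : α → ℝ} (hp : IsPMF p) {p₁ : X₁ → ℝ} {p₂ : X₂ → ℝ}
    {f : X₁ → X₂ → α}
    (h : ∀ a, pushf (fun x : X₁ × X₂ => p₁ x.1 * p₂ x.2) (fun x => f x.1 x.2) a = p a) :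
    (triv p hp).Observes (fun x : X₁ × X₂ => p₁ x.1 * p₂ x.2) (fun x => f x.1 x.2)
      (fun _ => ()) := fun u φ => by
  rw [E_triv, sum_mul_eq_of_pushf h]
  simp [triv]

theorem layer_observes {p₁ : X₁ → ℝ} {p₂ : X₂ → ℝ} (h₁ : IsPMF p₁) (h₂ : IsPMF p₂)
    (f : X₁ → X₂ → α) :
    (layer p₁ p₂ h₁ h₂ f).Observes (fun x : X₁ × X₂ => p₁ x.1 * p₂ x.2) (fun x => f x.1 x.2)
      Prod.fst := fun u φ => by
  rw [E_layer, Fintype.sum_prod_type, Finset.sum_comm, Finset.mul_sum]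
  refine Finset.sum_congr rfl fun x _ => ?_
  simp only [layer, Finset.sum_ite_eq', Finset.mem_univ, if_true]
  ring

theorem both_observes {p₁ : X₁ → ℝ} {p₂ : X₂ → ℝ} (h₁ : IsPMF p₁) (h₂ : IsPMF p₂)
    (f : X₁ → X₂ → α) :
    (both p₁ p₂ h₁ h₂ f).Observes (fun x : X₁ × X₂ => p₁ x.1 * p₂ x.2) (fun x => f x.1 x.2)
      id := fun u φ => by
  rw [E_both]
  simp [both]

end OneUser

section ThreeUsers

variable {U U' V V' W W' : Type} [Fintype U] [Fintype U'] [Fintype V] [Fintype V'] [Fintype W]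
  [Fintype W']

/-- The law of the channel output given the three observations. -/
def out (ch : 𝒜 → ℬ → 𝒞 → 𝒴 → ℝ) (P : View U 𝒜) (Q : View V ℬ) (R : View W 𝒞)
    (u : U) (v : V) (w : W) (y : 𝒴) : ℝ :=
  P.E u fun a => Q.E v fun b => R.E w fun c => ch a b c y

/-- The conditional entropy of the channel output given three independent observations. -/
def condEnt (ch : 𝒜 → ℬ → 𝒞 → 𝒴 → ℝ) (P : View U 𝒜) (Q : View V ℬ) (R : View W 𝒞) : ℝ :=
  ∑ u, ∑ v, ∑ w, P.π u * Q.π v * R.π w * ∑ y, Real.negMulLog (out ch P Q R u v w y)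

theorem condEnt_swap_left (ch : 𝒜 → ℬ → 𝒞 → 𝒴 → ℝ) (P : View U 𝒜) (Q : View V ℬ) (R : View W 𝒞) :
    condEnt (fun b a => ch a b) Q P R = condEnt ch P Q R := by
  unfold condEnt
  rw [Finset.sum_comm]
  refine Finset.sum_congr rfl fun u _ => Finset.sum_congr rfl fun v _ =>
    Finset.sum_congr rfl fun w _ => ?_
  simp only [out]
  rw [mul_comm (Q.π v)]
  refine congrArg _ (Finset.sum_congr rfl fun y _ => congrArg _ ?_)
  exact E_comm Q P v u _

theorem condEnt_swap_right (ch : 𝒜 → ℬ → 𝒞 → 𝒴 → ℝ) (P : View U 𝒜) (Q : View V ℬ) (R : View W 𝒞) :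
    condEnt (fun a c b => ch a b c) P R Q = condEnt ch P Q R := by
  unfold condEnt
  refine Finset.sum_congr rfl fun u _ => ?_
  rw [Finset.sum_comm]
  refine Finset.sum_congr rfl fun v _ => Finset.sum_congr rfl fun w _ => ?_
  simp only [out]
  rw [mul_right_comm (P.π u)]
  simp only [E_comm R Q w v]

theorem condEnt_submodular_left {ch : 𝒜 → ℬ → 𝒞 → 𝒴 → ℝ} (hch : ∀ a b c y, 0 ≤ ch a b c y)
    {P : View U 𝒜} {P' : View U' 𝒜} {Q : View V ℬ} {Q' : View V' ℬ} (R : View W 𝒞)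
    (hP : P.Coarser P') (hQ : Q.Coarser Q') :
    condEnt ch P Q R + condEnt ch P' Q' R ≤ condEnt ch P Q' R + condEnt ch P' Q R := by
  obtain ⟨ρ, hρ, hρκ, hρπ⟩ := hP
  obtain ⟨τ, hτ, hτκ, hτπ⟩ := hQ
  have e : ∀ {U V : Type} [Fintype U] [Fintype V] (P : View U 𝒜) (Q : View V ℬ), condEnt ch P Q R
      = ∑ w, ∑ y, R.π w * ∑ u, ∑ v, P.π u * Q.π v * Real.negMulLog (out ch P Q R u v w y) := by
    intro U V _ _ P Q
    unfold condEnt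
    simp only [Finset.mul_sum]
    calc _ = ∑ u, ∑ w, ∑ v, ∑ y, _ := Finset.sum_congr rfl fun _ _ => Finset.sum_comm
      _ = ∑ w, ∑ u, ∑ v, ∑ y, _ := Finset.sum_comm
      _ = ∑ w, ∑ u, ∑ y, ∑ v, _ := Finset.sum_congr rfl fun _ _ =>
          Finset.sum_congr rfl fun _ _ => Finset.sum_comm
      _ = ∑ w, ∑ y, ∑ u, ∑ v, _ := Finset.sum_congr rfl fun _ _ => Finset.sum_comm
      _ = _ := Finset.sum_congr rfl fun _ _ => Finset.sum_congr rfl fun _ _ =>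
          Finset.sum_congr rfl fun _ _ => Finset.sum_congr rfl fun _ _ => by ring
  simp only [e, ← Finset.sum_add_distrib, ← mul_add]
  refine Finset.sum_le_sum fun w _ => Finset.sum_le_sum fun y _ =>
    mul_le_mul_of_nonneg_left ?_ (R.π_nonneg w)
  have hl : ∀ {V : Type} [Fintype V] (S : View V ℬ) u v,
      out ch P S R u v w y = ∑ u', ρ u u' * out ch P' S R u' v w y :=
    fun S u v => E_eq_sum_E hρκ _ _
  have hr : ∀ {U : Type} [Fintype U] (S : View U 𝒜) u v,
      out ch S Q R u v w y = ∑ v', τ v v' * out ch S Q' R u v' w y := by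
    intro U _ S u v
    simp only [out, E_eq_sum_E hτκ, E_sum, E_mul_left]
  exact sum_negMulLog_submodular P.π P'.π Q.π Q'.π ρ τ _ _ _ _ P.π_nonneg Q.π_nonneg hρ hτ hρπ hτπ
    (fun u v => E_nonneg _ _ fun a => E_nonneg _ _ fun b => E_nonneg _ _ fun c => hch a b c y)
    (hl Q) (hr P) (hr P') (hl Q')

theorem condEnt_submodular_right {ch : 𝒜 → ℬ → 𝒞 → 𝒴 → ℝ} (hch : ∀ a b c y, 0 ≤ ch a b c y)
    (P : View U 𝒜) {Q : View V ℬ} {Q' : View V' ℬ} {R : View W 𝒞} {R' : View W' 𝒞}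
    (hQ : Q.Coarser Q') (hR : R.Coarser R') :
    condEnt ch P Q R + condEnt ch P Q' R' ≤ condEnt ch P Q R' + condEnt ch P Q' R := by
  simp only [← condEnt_swap_left ch, ← condEnt_swap_right (fun b a => ch a b)]
  exact condEnt_submodular_left (fun b c a y => hch a b c y) P hQ hR

theorem condEnt_submodular_outer {ch : 𝒜 → ℬ → 𝒞 → 𝒴 → ℝ} (hch : ∀ a b c y, 0 ≤ ch a b c y)
    {P : View U 𝒜} {P' : View U' 𝒜} (Q : View V ℬ) {R : View W 𝒞} {R' : View W' 𝒞}
    (hP : P.Coarser P') (hR : R.Coarser R') :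
    condEnt ch P Q R + condEnt ch P' Q R' ≤ condEnt ch P Q R' + condEnt ch P' Q R := by
  simp only [← condEnt_swap_right ch]
  exact condEnt_submodular_left (fun a c b y => hch a b c y) Q hP hR

theorem condEnt_both_left {X₁ X₂ : Type} [Fintype X₁] [Fintype X₂] (ch : 𝒜 → ℬ → 𝒞 → 𝒴 → ℝ)
    {p : 𝒜 → ℝ} (hp : IsPMF p) {p₁ : X₁ → ℝ} {p₂ : X₂ → ℝ} (h₁ : IsPMF p₁) (h₂ : IsPMF p₂)
    {f : X₁ → X₂ → 𝒜}
    (h : ∀ a, pushf (fun x : X₁ × X₂ => p₁ x.1 * p₂ x.2) (fun x => f x.1 x.2) a = p a)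
    (Q : View V ℬ) (R : View W 𝒞) :
    condEnt ch (both p₁ p₂ h₁ h₂ f) Q R = condEnt ch (full p hp) Q R := by
  have := sum_mul_eq_of_pushf h fun a => ∑ v, ∑ w, Q.π v * R.π w *
    ∑ y, Real.negMulLog (Q.E v fun b => R.E w fun c => ch a b c y)
  simp only [Finset.mul_sum] at this
  simp only [condEnt, out, E_both, Finset.mul_sum]
  refine Eq.trans ?_ (this.symm.trans ?_)
  · refine Finset.sum_congr rfl fun _ _ => Finset.sum_congr rfl fun _ _ =>
      Finset.sum_congr rfl fun _ _ => Finset.sum_congr rfl fun _ _ => ?_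
    simp only [both]
    ring
  · refine Finset.sum_congr rfl fun a _ => Finset.sum_congr rfl fun _ _ =>
      Finset.sum_congr rfl fun _ _ => Finset.sum_congr rfl fun _ _ => ?_
    rw [E_full]
    simp only [full]
    ring

theorem condEnt_both_mid {X₁ X₂ : Type} [Fintype X₁] [Fintype X₂] (ch : 𝒜 → ℬ → 𝒞 → 𝒴 → ℝ)
    {p : ℬ → ℝ} (hp : IsPMF p) {p₁ : X₁ → ℝ} {p₂ : X₂ → ℝ} (h₁ : IsPMF p₁) (h₂ : IsPMF p₂)
    {f : X₁ → X₂ → ℬ}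
    (h : ∀ a, pushf (fun x : X₁ × X₂ => p₁ x.1 * p₂ x.2) (fun x => f x.1 x.2) a = p a)
    (P : View U 𝒜) (R : View W 𝒞) :
    condEnt ch P (both p₁ p₂ h₁ h₂ f) R = condEnt ch P (full p hp) R := by
  rw [← condEnt_swap_left, condEnt_both_left _ hp h₁ h₂ h, condEnt_swap_left]

/-- A joint pmf of two independent sources `x`, `x'`, an input `c` and the channel output:
conditional entropies of the output are given by the views of the inputs. -/
theorem condHof_eq_condEnt {Ω X X' : Type} {ξ : Type*} [Fintype Ω] [Fintype X] [Fintype X']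
    [Fintype ξ] {ch : 𝒜 → ℬ → 𝒞 → 𝒴 → ℝ} (hch : ∀ a b c, ∑ y, ch a b c y = 1)
    {p : X → ℝ} {p' : X' → ℝ} {pC : 𝒞 → ℝ} {f : X → 𝒜} {f' : X' → ℬ}
    (e : Ω ≃ X × X' × 𝒞 × 𝒴) {q : Ω → ℝ}
    (hq : ∀ ω, q ω = p (e ω).1 * p' (e ω).2.1 * pC (e ω).2.2.1 *
      ch (f (e ω).1) (f' (e ω).2.1) (e ω).2.2.1 (e ω).2.2.2)
    {P : View U 𝒜} {Q : View V ℬ} {R : View W 𝒞} {g : X → U} {g' : X' → V} {g'' : 𝒞 → W}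
    (hP : P.Observes p f g) (hQ : Q.Observes p' f' g') (hR : R.Observes pC id g'')
    {S : Ω → ξ} (hS : ∀ ω ω', S ω = S ω' ↔ g (e ω).1 = g (e ω').1 ∧
      g' (e ω).2.1 = g' (e ω').2.1 ∧ g'' (e ω).2.2.1 = g'' (e ω').2.2.1) :
    condHof q S (fun ω => (e ω).2.2.2) = condEnt ch P Q R := by
  rw [condHof_congr q (B := fun ω => (g (e ω).1, g' (e ω).2.1, g'' (e ω).2.2.1)) _
      (by simpa using hS),
    condHof_eq_sum q _ _ (fun z => P.π z.1 * Q.π z.2.1 * R.π z.2.2)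
      (fun z => out ch P Q R z.1 z.2.1 z.2.2)]
  · simp only [Fintype.sum_prod_type, condEnt]
  · rintro ⟨u, v, w⟩ y
    simp only [pushf, hq]
    rw [e.sum_comp fun z => if ((g z.1, g' z.2.1, g'' z.2.2.1), z.2.2.2) = ((u, v, w), y) then
      p z.1 * p' z.2.1 * pC z.2.2.1 * ch (f z.1) (f' z.2.1) z.2.2.1 z.2.2.2 else 0]
    simp only [Fintype.sum_prod_type, Prod.mk.injEq]
    calc _ = ∑ x, if g x = u then p x * (∑ x', if g' x' = v then p' x' *
          (∑ c, if g'' c = w then pC c * ch (f x) (f' x') c y else 0) else 0) else 0 := by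
          refine Finset.sum_congr rfl fun x _ => ?_
          by_cases h : g x = u
          · simp only [h, true_and, if_true, Finset.mul_sum]
            refine Finset.sum_congr rfl fun x' _ => ?_
            by_cases h' : g' x' = v
            · simp only [h', true_and, if_true, Finset.mul_sum]
              refine Finset.sum_congr rfl fun c _ => ?_
              by_cases h'' : g'' c = w
              · simp only [h'', true_and, if_true, Finset.sum_ite_eq', Finset.mem_univ]
                ring
              · simp [h'']
            · simp [h']
          · simp [h]
      _ = _ := by
          simp only [out]
          rw [show P.π u * Q.π v * R.π w * P.E u (fun a => Q.E v fun b => R.E w fun c => ch a b c y)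
            = P.π u * P.E u (fun a => Q.π v * Q.E v fun b => R.π w * R.E w fun c => ch a b c y) by
              simp only [E_mul_left]; ring, hP u]
          simp only [hQ v, hR w, id]
  · rintro ⟨u, v, w⟩
    simp only [out, ← E_sum, hch, E_one]

end ThreeUsers

end View

section Regions

open View

theorem sum_macJoint {pA : 𝒜 → ℝ} {pB : ℬ → ℝ} {pC : 𝒞 → ℝ} {ch : 𝒜 → ℬ → 𝒞 → 𝒴 → ℝ}
    (hpA : IsPMF pA) (hpB : IsPMF pB) (hpC : IsPMF pC) (hch : ∀ a b c, ∑ y, ch a b c y = 1) :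
    ∑ ω, macJoint pA pB pC ch ω = 1 := by
  simp only [macJoint, Fintype.sum_prod_type, ← Finset.mul_sum, hch, hpA.2, hpB.2, hpC.2, mul_one]

theorem sum_macSplitJoint (s : MacSplit 𝒜 ℬ 𝒞) {ch : 𝒜 → ℬ → 𝒞 → 𝒴 → ℝ}
    (hch : ∀ a b c, ∑ y, ch a b c y = 1) : ∑ ω, macSplitJoint s ch ω = 1 := by
  simp only [macSplitJoint, Fintype.sum_prod_type, ← Finset.mul_sum, hch, s.pa1_pmf.2, s.pa2_pmf.2,
    s.pb1_pmf.2, s.pb2_pmf.2, s.pc_pmf.2, mul_one]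

theorem mem_RMAC_iff {pA : 𝒜 → ℝ} {pB : ℬ → ℝ} {pC : 𝒞 → ℝ} {ch : 𝒜 → ℬ → 𝒞 → 𝒴 → ℝ}
    (hpA : IsPMF pA) (hpB : IsPMF pB) (hpC : IsPMF pC) (hch : ∀ a b c, ∑ y, ch a b c y = 1)
    (r : ℝ × ℝ × ℝ) :
    r ∈ RMAC pA pB pC ch ↔ 0 ≤ r.1 ∧ 0 ≤ r.2.1 ∧ 0 ≤ r.2.2 ∧
      r.1 ≤ condEnt ch (triv pA hpA) (full pB hpB) (full pC hpC)
        - condEnt ch (full pA hpA) (full pB hpB) (full pC hpC) ∧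
      r.2.1 ≤ condEnt ch (full pA hpA) (triv pB hpB) (full pC hpC)
        - condEnt ch (full pA hpA) (full pB hpB) (full pC hpC) ∧
      r.2.2 ≤ condEnt ch (full pA hpA) (full pB hpB) (triv pC hpC)
        - condEnt ch (full pA hpA) (full pB hpB) (full pC hpC) ∧
      r.1 + r.2.1 ≤ condEnt ch (triv pA hpA) (triv pB hpB) (full pC hpC)
        - condEnt ch (full pA hpA) (full pB hpB) (full pC hpC) ∧
      r.1 + r.2.2 ≤ condEnt ch (triv pA hpA) (full pB hpB) (triv pC hpC)
        - condEnt ch (full pA hpA) (full pB hpB) (full pC hpC) ∧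
      r.2.1 + r.2.2 ≤ condEnt ch (full pA hpA) (triv pB hpB) (triv pC hpC)
        - condEnt ch (full pA hpA) (full pB hpB) (full pC hpC) ∧
      r.1 + r.2.1 + r.2.2 ≤ condEnt ch (triv pA hpA) (triv pB hpB) (triv pC hpC)
        - condEnt ch (full pA hpA) (full pB hpB) (full pC hpC) := by
  have key : ∀ {U V W ξ : Type} [Fintype U] [Fintype V] [Fintype W] [Fintype ξ]
      {P : View U 𝒜} {Q : View V ℬ} {R : View W 𝒞} {g : 𝒜 → U} {g' : ℬ → V} {g'' : 𝒞 → W}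
      (_ : P.Observes pA id g) (_ : Q.Observes pB id g') (_ : R.Observes pC id g'')
      {S : 𝒜 × ℬ × 𝒞 × 𝒴 → ξ} (_ : ∀ ω ω', S ω = S ω' ↔ g ω.1 = g ω'.1 ∧
        g' ω.2.1 = g' ω'.2.1 ∧ g'' ω.2.2.1 = g'' ω'.2.2.1),
      condHof (macJoint pA pB pC ch) S (fun ω => ω.2.2.2) = condEnt ch P Q R :=
    fun hP hQ hR _ hS => condHof_eq_condEnt hch (Equiv.refl _) (fun _ => rfl) hP hQ hR hS
  have tA := triv_observes hpA
  have tB := triv_observes hpB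
  have tC := triv_observes hpC
  have fA := full_observes hpA
  have fB := full_observes hpB
  have fC := full_observes hpC
  unfold RMAC
  simp only [cmiOf_eq_condHof, miOf_eq_condHof _ (sum_macJoint hpA hpB hpC hch), Set.mem_ofPred_eq]
  rw [key tA fB fC (S := fun ω => (ω.2.1, ω.2.2.1)) (by simp),
    key fA fB fC (S := fun ω => (ω.1, ω.2.1, ω.2.2.1)) (by simp),
    key fA tB fC (S := fun ω => (ω.1, ω.2.2.1)) (by simp),
    key fA fB fC (S := fun ω => (ω.2.1, ω.1, ω.2.2.1)) (by simp; tauto),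
    key fA fB tC (S := fun ω => (ω.1, ω.2.1)) (by simp),
    key fA fB fC (S := fun ω => (ω.2.2.1, ω.1, ω.2.1)) (by simp; tauto),
    key tA tB fC (S := fun ω => ω.2.2.1) (by simp),
    key fA fB fC (S := fun ω => ((ω.1, ω.2.1), ω.2.2.1)) (by simp; tauto),
    key tA fB tC (S := fun ω => ω.2.1) (by simp),
    key fA fB fC (S := fun ω => ((ω.1, ω.2.2.1), ω.2.1)) (by simp; tauto),
    key fA tB tC (S := fun ω => ω.1) (by simp),
    key fA fB fC (S := fun ω => ((ω.2.1, ω.2.2.1), ω.1)) (by simp; tauto),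
    key tA tB tC (S := fun _ => ()) (by simp)]

variable {pA : 𝒜 → ℝ} {pB : ℬ → ℝ} {pC : 𝒞 → ℝ} {ch : 𝒜 → ℬ → 𝒞 → 𝒴 → ℝ}

/-- The first layer of `A`, as a view of `A`. -/
def MacSplit.viewA (s : MacSplit 𝒜 ℬ 𝒞) : View s.A1 𝒜 :=
  layer s.pa1 s.pa2 s.pa1_pmf s.pa2_pmf s.fa

/-- The first layer of `B`, as a view of `B`. -/
def MacSplit.viewB (s : MacSplit 𝒜 ℬ 𝒞) : View s.B1 ℬ :=
  layer s.pb1 s.pb2 s.pb1_pmf s.pb2_pmf s.fb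

/-- Grouping of the layers by user. -/
def MacSplit.group (s : MacSplit 𝒜 ℬ 𝒞) (𝒴 : Type) :
    s.A1 × s.A2 × s.B1 × s.B2 × 𝒞 × 𝒴 ≃ (s.A1 × s.A2) × (s.B1 × s.B2) × 𝒞 × 𝒴 where
  toFun ω := ((ω.1, ω.2.1), (ω.2.2.1, ω.2.2.2.1), ω.2.2.2.2)
  invFun z := (z.1.1, z.1.2, z.2.1.1, z.2.1.2, z.2.2)

theorem condHof_macSplitJoint (s : MacSplit 𝒜 ℬ 𝒞) (hs : s.pc = pC)
    (hch : ∀ a b c, ∑ y, ch a b c y = 1)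
    {U V W ξ : Type} [Fintype U] [Fintype V] [Fintype W] [Fintype ξ]
    {P : View U 𝒜} {Q : View V ℬ} {R : View W 𝒞}
    {g : s.A1 × s.A2 → U} {g' : s.B1 × s.B2 → V} {g'' : 𝒞 → W}
    (hP : P.Observes (fun x : s.A1 × s.A2 => s.pa1 x.1 * s.pa2 x.2) (fun x => s.fa x.1 x.2) g)
    (hQ : Q.Observes (fun x : s.B1 × s.B2 => s.pb1 x.1 * s.pb2 x.2) (fun x => s.fb x.1 x.2) g')
    (hR : R.Observes pC id g'') (S : s.A1 × s.A2 × s.B1 × s.B2 × 𝒞 × 𝒴 → ξ)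
    (hS : ∀ ω ω', S ω = S ω' ↔ g (ω.1, ω.2.1) = g (ω'.1, ω'.2.1) ∧
      g' (ω.2.2.1, ω.2.2.2.1) = g' (ω'.2.2.1, ω'.2.2.2.1) ∧
      g'' ω.2.2.2.2.1 = g'' ω'.2.2.2.2.1) :
    condHof (macSplitJoint s ch) S (fun ω => ω.2.2.2.2.2) = condEnt ch P Q R := by
  refine condHof_eq_condEnt hch (s.group 𝒴) (fun ω => ?_) hP hQ hR hS
  simp only [macSplitJoint, MacSplit.group, Equiv.coe_fn_mk, hs]
  ring

theorem mem_RMacSplit1_iff {s : MacSplit 𝒜 ℬ 𝒞} (hs : s.Matches pA pB pC)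
    (hpA : IsPMF pA) (hpB : IsPMF pB) (hpC : IsPMF pC) (hch : ∀ a b c, ∑ y, ch a b c y = 1)
    (r : ℝ × ℝ × ℝ) : r ∈ RMacSplit1 s ch ↔ 0 ≤ r.1 ∧ 0 ≤ r.2.1 ∧ 0 ≤ r.2.2 ∧
    r.1 ≤ (condEnt ch (triv pA hpA) (triv pB hpB) (triv pC hpC)
        - condEnt ch s.viewA (triv pB hpB) (triv pC hpC))
      + (condEnt ch s.viewA s.viewB (triv pC hpC)
        - condEnt ch (full pA hpA) s.viewB (triv pC hpC)) ∧
    r.2.1 ≤ (condEnt ch s.viewA (triv pB hpB) (triv pC hpC)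
        - condEnt ch s.viewA s.viewB (triv pC hpC))
      + (condEnt ch (full pA hpA) s.viewB (full pC hpC)
        - condEnt ch (full pA hpA) (full pB hpB) (full pC hpC)) ∧
    r.2.2 ≤ (condEnt ch (full pA hpA) s.viewB (triv pC hpC)
        - condEnt ch (full pA hpA) s.viewB (full pC hpC)) := by
  have tA := triv_observes_layers hpA hs.1
  have tB := triv_observes_layers hpB hs.2.1
  have lA := layer_observes s.pa1_pmf s.pa2_pmf s.fa
  have lB := layer_observes s.pb1_pmf s.pb2_pmf s.fb
  have bA := both_observes s.pa1_pmf s.pa2_pmf s.fa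
  have bB := both_observes s.pb1_pmf s.pb2_pmf s.fb
  have tC := triv_observes hpC
  have fC := full_observes hpC
  unfold RMacSplit1
  simp only [cmiOf_eq_condHof, miOf_eq_condHof _ (sum_macSplitJoint s hch), Set.mem_ofPred_eq,
    ← condEnt_both_left ch hpA s.pa1_pmf s.pa2_pmf hs.1,
    ← condEnt_both_mid ch hpB s.pb1_pmf s.pb2_pmf hs.2.1]
  rw [condHof_macSplitJoint s hs.2.2 hch tA tB tC
      (fun _ => ()) (by simp),
    condHof_macSplitJoint s hs.2.2 hch lA tB tC
      (fun ω => ω.1) (by simp),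
    condHof_macSplitJoint s hs.2.2 hch lA lB tC
      (fun ω => (ω.2.2.1, ω.1)) (by simp; tauto),
    condHof_macSplitJoint s hs.2.2 hch lA lB tC
      (fun ω => (ω.1, ω.2.2.1)) (by simp),
    condHof_macSplitJoint s hs.2.2 hch bA lB tC
      (fun ω => (ω.2.1, ω.1, ω.2.2.1)) (by simp; tauto),
    condHof_macSplitJoint s hs.2.2 hch bA lB tC
      (fun ω => (ω.1, ω.2.2.1, ω.2.1)) (by simp; tauto),
    condHof_macSplitJoint s hs.2.2 hch bA lB fC
      (fun ω => (ω.2.2.2.2.1, ω.1, ω.2.2.1, ω.2.1)) (by simp; tauto),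
    condHof_macSplitJoint s hs.2.2 hch bA lB fC
      (fun ω => (ω.1, ω.2.2.1, ω.2.1, ω.2.2.2.2.1)) (by simp; tauto),
    condHof_macSplitJoint s hs.2.2 hch bA bB fC
      (fun ω => (ω.2.2.2.1, ω.1, ω.2.2.1, ω.2.1, ω.2.2.2.2.1)) (by simp; tauto)]
  rfl

theorem mem_RMacSplit2_iff {s : MacSplit 𝒜 ℬ 𝒞} (hs : s.Matches pA pB pC)
    (hpA : IsPMF pA) (hpB : IsPMF pB) (hpC : IsPMF pC) (hch : ∀ a b c, ∑ y, ch a b c y = 1)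
    (r : ℝ × ℝ × ℝ) : r ∈ RMacSplit2 s ch ↔ 0 ≤ r.1 ∧ 0 ≤ r.2.1 ∧ 0 ≤ r.2.2 ∧
    r.1 ≤ (condEnt ch (triv pA hpA) s.viewB (full pC hpC)
        - condEnt ch s.viewA s.viewB (full pC hpC))
      + (condEnt ch s.viewA (full pB hpB) (full pC hpC)
        - condEnt ch (full pA hpA) (full pB hpB) (full pC hpC)) ∧
    r.2.1 ≤ (condEnt ch (triv pA hpA) (triv pB hpB) (triv pC hpC)
        - condEnt ch (triv pA hpA) s.viewB (triv pC hpC))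
      + (condEnt ch s.viewA s.viewB (full pC hpC)
        - condEnt ch s.viewA (full pB hpB) (full pC hpC)) ∧
    r.2.2 ≤ (condEnt ch (triv pA hpA) s.viewB (triv pC hpC)
        - condEnt ch (triv pA hpA) s.viewB (full pC hpC)) := by
  have tA := triv_observes_layers hpA hs.1
  have tB := triv_observes_layers hpB hs.2.1
  have lA := layer_observes s.pa1_pmf s.pa2_pmf s.fa
  have lB := layer_observes s.pb1_pmf s.pb2_pmf s.fb
  have bA := both_observes s.pa1_pmf s.pa2_pmf s.fa
  have bB := both_observes s.pb1_pmf s.pb2_pmf s.fb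
  have tC := triv_observes hpC
  have fC := full_observes hpC
  unfold RMacSplit2
  simp only [cmiOf_eq_condHof, miOf_eq_condHof _ (sum_macSplitJoint s hch), Set.mem_ofPred_eq,
    ← condEnt_both_left ch hpA s.pa1_pmf s.pa2_pmf hs.1,
    ← condEnt_both_mid ch hpB s.pb1_pmf s.pb2_pmf hs.2.1]
  rw [condHof_macSplitJoint s hs.2.2 hch tA tB tC
      (fun _ => ()) (by simp),
    condHof_macSplitJoint s hs.2.2 hch tA lB tC
      (fun ω => ω.2.2.1) (by simp),
    condHof_macSplitJoint s hs.2.2 hch tA lB fC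
      (fun ω => (ω.2.2.2.2.1, ω.2.2.1)) (by simp; tauto),
    condHof_macSplitJoint s hs.2.2 hch tA lB fC
      (fun ω => (ω.2.2.1, ω.2.2.2.2.1)) (by simp),
    condHof_macSplitJoint s hs.2.2 hch lA lB fC
      (fun ω => (ω.1, ω.2.2.1, ω.2.2.2.2.1)) (by simp),
    condHof_macSplitJoint s hs.2.2 hch lA lB fC
      (fun ω => (ω.2.2.1, ω.2.2.2.2.1, ω.1)) (by simp; tauto),
    condHof_macSplitJoint s hs.2.2 hch lA bB fC
      (fun ω => (ω.2.2.2.1, ω.2.2.1, ω.2.2.2.2.1, ω.1)) (by simp; tauto),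
    condHof_macSplitJoint s hs.2.2 hch lA bB fC
      (fun ω => (ω.2.2.1, ω.2.2.2.2.1, ω.1, ω.2.2.2.1)) (by simp; tauto),
    condHof_macSplitJoint s hs.2.2 hch bA bB fC
      (fun ω => (ω.2.1, ω.2.2.1, ω.2.2.2.2.1, ω.1, ω.2.2.2.1)) (by simp; tauto)]
  rfl

theorem mem_RMacSplit3_iff {s : MacSplit 𝒜 ℬ 𝒞} (hs : s.Matches pA pB pC)
    (hpA : IsPMF pA) (hpB : IsPMF pB) (hpC : IsPMF pC) (hch : ∀ a b c, ∑ y, ch a b c y = 1)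
    (r : ℝ × ℝ × ℝ) : r ∈ RMacSplit3 s ch ↔ 0 ≤ r.1 ∧ 0 ≤ r.2.1 ∧ 0 ≤ r.2.2 ∧
    r.1 ≤ (condEnt ch (triv pA hpA) s.viewB (triv pC hpC)
        - condEnt ch s.viewA s.viewB (triv pC hpC))
      + (condEnt ch s.viewA s.viewB (full pC hpC)
        - condEnt ch (full pA hpA) s.viewB (full pC hpC)) ∧
    r.2.1 ≤ (condEnt ch (triv pA hpA) (triv pB hpB) (triv pC hpC)
        - condEnt ch (triv pA hpA) s.viewB (triv pC hpC))
      + (condEnt ch (full pA hpA) s.viewB (full pC hpC)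
        - condEnt ch (full pA hpA) (full pB hpB) (full pC hpC)) ∧
    r.2.2 ≤ (condEnt ch s.viewA s.viewB (triv pC hpC)
        - condEnt ch s.viewA s.viewB (full pC hpC)) := by
  have tA := triv_observes_layers hpA hs.1
  have tB := triv_observes_layers hpB hs.2.1
  have lA := layer_observes s.pa1_pmf s.pa2_pmf s.fa
  have lB := layer_observes s.pb1_pmf s.pb2_pmf s.fb
  have bA := both_observes s.pa1_pmf s.pa2_pmf s.fa
  have bB := both_observes s.pb1_pmf s.pb2_pmf s.fb
  have tC := triv_observes hpC
  have fC := full_observes hpC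
  unfold RMacSplit3
  simp only [cmiOf_eq_condHof, miOf_eq_condHof _ (sum_macSplitJoint s hch), Set.mem_ofPred_eq,
    ← condEnt_both_left ch hpA s.pa1_pmf s.pa2_pmf hs.1,
    ← condEnt_both_mid ch hpB s.pb1_pmf s.pb2_pmf hs.2.1]
  rw [condHof_macSplitJoint s hs.2.2 hch tA tB tC
      (fun _ => ()) (by simp),
    condHof_macSplitJoint s hs.2.2 hch tA lB tC
      (fun ω => ω.2.2.1) (by simp),
    condHof_macSplitJoint s hs.2.2 hch lA lB tC
      (fun ω => (ω.1, ω.2.2.1)) (by simp),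
    condHof_macSplitJoint s hs.2.2 hch lA lB tC
      (fun ω => (ω.2.2.1, ω.1)) (by simp; tauto),
    condHof_macSplitJoint s hs.2.2 hch lA lB fC
      (fun ω => (ω.2.2.2.2.1, ω.2.2.1, ω.1)) (by simp; tauto),
    condHof_macSplitJoint s hs.2.2 hch lA lB fC
      (fun ω => (ω.2.2.1, ω.1, ω.2.2.2.2.1)) (by simp; tauto),
    condHof_macSplitJoint s hs.2.2 hch bA lB fC
      (fun ω => (ω.2.1, ω.2.2.1, ω.1, ω.2.2.2.2.1)) (by simp; tauto),
    condHof_macSplitJoint s hs.2.2 hch bA lB fC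
      (fun ω => (ω.2.2.1, ω.1, ω.2.2.2.2.1, ω.2.1)) (by simp; tauto),
    condHof_macSplitJoint s hs.2.2 hch bA bB fC
      (fun ω => (ω.2.2.2.1, ω.2.2.1, ω.1, ω.2.2.2.2.1, ω.2.1)) (by simp; tauto)]
  rfl

end Regions

theorem exists_convex_combination {a b r : ℝ} (ha : a ≤ r) (hb : r ≤ b) :
    ∃ t, 0 ≤ t ∧ t ≤ 1 ∧ r = t * b + (1 - t) * a := by
  rcases (ha.trans hb).eq_or_lt with h | h
  · exact ⟨0, le_rfl, zero_le_one, by linarith⟩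
  · have h' : 0 < b - a := sub_pos.2 h
    refine ⟨(r - a) / (b - a), div_nonneg (by linarith) h'.le, (div_le_one h').2 (by linarith), ?_⟩
    field_simp
    ring

theorem exists_tight_of_le {x a b c d : ℝ} (ha : x ≤ a) (hb : x ≤ b) (hc : x ≤ c) (hd : x ≤ d) :
    ∃ y, x ≤ y ∧ y ≤ a ∧ y ≤ b ∧ y ≤ c ∧ y ≤ d ∧ (y = a ∨ y = b ∨ y = c ∨ y = d) := by
  refine ⟨min (min a b) (min c d), by simp [*], by simp, by simp, by simp, by simp, ?_⟩
  rcases min_choice (min a b) (min c d) with h | h <;> rw [h]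
  · rcases min_choice a b with h | h <;> simp [h]
  · rcases min_choice c d with h | h <;> simp [h]

/-- Every point of a three-dimensional polymatroid is dominated by one on its dominant face. -/
theorem exists_dominant {g₁ g₂ g₃ g₁₂ g₁₃ g₂₃ g r₁ r₂ r₃ : ℝ}
    (s₁₂ : g₁₂ ≤ g₁ + g₂) (s₁₃ : g₁₃ ≤ g₁ + g₃)
    (t₁ : g + g₁ ≤ g₁₂ + g₁₃) (t₂ : g + g₂ ≤ g₁₂ + g₂₃) (t₃ : g + g₃ ≤ g₁₃ + g₂₃)
    (h₁ : r₁ ≤ g₁) (h₂ : r₂ ≤ g₂) (h₃ : r₃ ≤ g₃) (h₁₂ : r₁ + r₂ ≤ g₁₂) (h₁₃ : r₁ + r₃ ≤ g₁₃)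
    (h₂₃ : r₂ + r₃ ≤ g₂₃) (h : r₁ + r₂ + r₃ ≤ g) :
    ∃ x y z, r₁ ≤ x ∧ r₂ ≤ y ∧ r₃ ≤ z ∧ x ≤ g₁ ∧ y ≤ g₂ ∧ z ≤ g₃ ∧ x + y ≤ g₁₂ ∧ x + z ≤ g₁₃ ∧
      y + z ≤ g₂₃ ∧ x + y + z = g := by
  obtain ⟨x, hx, x1, x2, x3, x4, hx'⟩ := exists_tight_of_le (x := r₁) (a := g₁) (b := g₁₂ - r₂)
    (c := g₁₃ - r₃) (d := g - r₂ - r₃) h₁ (by linarith) (by linarith) (by linarith)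
  obtain ⟨y, hy, y1, y2, y3, y4, hy'⟩ := exists_tight_of_le (x := r₂) (a := g₂) (b := g₁₂ - x)
    (c := g₂₃ - r₃) (d := g - x - r₃) h₂ (by linarith) (by linarith) (by linarith)
  obtain ⟨z, hz, z1, z2, z3, z4, hz'⟩ := exists_tight_of_le (x := r₃) (a := g₃) (b := g₁₃ - x)
    (c := g₂₃ - y) (d := g - x - y) h₃ (by linarith) (by linarith) (by linarith)
  refine ⟨x, y, z, hx, hy, hz, x1, y1, z1, by linarith, by linarith, by linarith,
    le_antisymm (by linarith) ?_⟩
  rcases hx' with hx' | hx' | hx' | hx' <;> rcases hy' with hy' | hy' | hy' | hy' <;>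
    rcases hz' with hz' | hz' | hz' | hz' <;> linarith

/-- Any point of the dominant face is met by one of the three layer orders with erasure
splits, `s` and `t` being the erasure probabilities of the first layers of `B` and `A`. -/
theorem exists_erasure_probabilities {h hA hB hC hAB hAC hBC hABC x y z : ℝ}
    (sAB : h + hAB ≤ hA + hB) (sABC : hC + hABC ≤ hAC + hBC)
    (h₁ : x ≤ hBC - hABC) (h₂ : y ≤ hAC - hABC) (h₃ : z ≤ hAB - hABC)
    (h₁₂ : x + y ≤ hC - hABC) (h₁₃ : x + z ≤ hB - hABC) (h₂₃ : y + z ≤ hA - hABC)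
    (hsum : x + y + z = h - hABC) :
    ∃ s t, 0 ≤ s ∧ s ≤ 1 ∧ 0 ≤ t ∧ t ≤ 1 ∧
      ((x = t * ((s * h + (1 - s) * hB) - (s * hA + (1 - s) * hAB)) + (1 - t) * (h - hA) ∧
        z = (s * hA + (1 - s) * hAB) - (s * hAC + (1 - s) * hABC)) ∨
      (x = t * (hBC - hABC) + (1 - t) * ((s * hC + (1 - s) * hBC) - (s * hAC + (1 - s) * hABC)) ∧
        z = (s * h + (1 - s) * hB) - (s * hC + (1 - s) * hBC)) ∨
      (x = t * ((s * hC + (1 - s) * hBC) - (s * hAC + (1 - s) * hABC))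
          + (1 - t) * ((s * h + (1 - s) * hB) - (s * hA + (1 - s) * hAB)) ∧
        y = s * (hAC - hABC) + (1 - s) * (h - hB))) := by
  obtain ⟨s, s0, s1, hs⟩ := exists_convex_combination (a := h - hB) (b := hAC - hABC) (r := y)
    (by linarith) h₂
  rcases lt_or_ge x ((s * h + (1 - s) * hB) - (s * hA + (1 - s) * hAB)) with hlo | hlo
  · obtain ⟨θ, θ0, θ1, hθ⟩ := exists_convex_combination
      (a := (s * hA + (1 - s) * hAB) - (s * hAC + (1 - s) * hABC)) (b := hAB - hABC) (r := z)
      (by linarith) h₃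
    have hmono : (s * h + (1 - s) * hB) - (s * hA + (1 - s) * hAB) ≤
        ((1 - θ) * s * h + (1 - (1 - θ) * s) * hB)
          - ((1 - θ) * s * hA + (1 - (1 - θ) * s) * hAB) := by
      linarith [mul_nonneg (mul_nonneg θ0 s0) (sub_nonneg.2 sAB)]
    obtain ⟨t, t0, t1, ht⟩ := exists_convex_combination (a := h - hA) (r := x) (by linarith)
      (hlo.le.trans hmono)
    exact ⟨(1 - θ) * s, t, mul_nonneg (by linarith) s0, mul_le_one₀ (by linarith) s0 s1, t0, t1,
      Or.inl ⟨ht, by linarith⟩⟩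
  rcases le_or_gt x ((s * hC + (1 - s) * hBC) - (s * hAC + (1 - s) * hABC)) with hhi | hhi
  · obtain ⟨t, t0, t1, ht⟩ := exists_convex_combination hlo hhi
    exact ⟨s, t, s0, s1, t0, t1, Or.inr (Or.inr ⟨ht, hs⟩)⟩
  · obtain ⟨θ, θ0, θ1, hθ⟩ := exists_convex_combination
      (a := h - hC) (b := (s * h + (1 - s) * hB) - (s * hC + (1 - s) * hBC)) (r := z)
      (by linarith) (by linarith)
    have h0 : 0 ≤ θ * (1 - s) := mul_nonneg θ0 (by linarith)
    have h1 : θ * (1 - s) ≤ 1 := mul_le_one₀ θ1 (by linarith) (by linarith)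
    have hmono : ((1 - θ * (1 - s)) * hC + (1 - (1 - θ * (1 - s))) * hBC)
        - ((1 - θ * (1 - s)) * hAC + (1 - (1 - θ * (1 - s))) * hABC)
        ≤ (s * hC + (1 - s) * hBC) - (s * hAC + (1 - s) * hABC) := by
      linarith [mul_nonneg (mul_nonneg (sub_nonneg.2 θ1) (sub_nonneg.2 s1)) (sub_nonneg.2 sABC)]
    obtain ⟨t, t0, t1, ht⟩ := exists_convex_combination (hmono.trans hhi.le) h₁
    exact ⟨1 - θ * (1 - s), t, by linarith, by linarith, t0, t1,
      Or.inr (Or.inl ⟨ht, by linarith⟩)⟩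

section Erasure

open View

variable {α : Type} [Fintype α]

/-- The law of an erased copy of a variable with law `p`, with erasure probability `t`. -/
def eraseLaw (t : ℝ) (p : α → ℝ) : Option α → ℝ
  | none => t
  | some a => (1 - t) * p a

theorem eraseLaw_isPMF {t : ℝ} (h0 : 0 ≤ t) (h1 : t ≤ 1) {p : α → ℝ} (hp : IsPMF p) :
    IsPMF (eraseLaw t p) := by
  refine ⟨?_, ?_⟩
  · rintro (_ | a)
    exacts [h0, mul_nonneg (by linarith) (hp.1 a)]
  · simp [Fintype.sum_option, eraseLaw, ← Finset.mul_sum, hp.2]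

theorem pushf_eraseLaw (t : ℝ) {p : α → ℝ} (hp : IsPMF p) (a : α) :
    pushf (fun x : Option α × α => eraseLaw t p x.1 * p x.2) (fun x => x.1.getD x.2) a = p a := by
  have : ∀ b, (∑ x, if b = a then (1 - t) * p b * p x else 0)
      = if b = a then (1 - t) * p b else 0 := fun b => by
    split_ifs <;> simp [← Finset.mul_sum, hp.2]
  simp [pushf, Fintype.sum_prod_type, Fintype.sum_option, eraseLaw, this]
  ring

theorem condEnt_erase_left (ch : 𝒜 → ℬ → 𝒞 → 𝒴 → ℝ) {V W : Type} [Fintype V] [Fintype W]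
    {p : 𝒜 → ℝ} (hp : IsPMF p) {t : ℝ} (ht : IsPMF (eraseLaw t p)) (Q : View V ℬ)
    (R : View W 𝒞) :
    condEnt ch (layer (eraseLaw t p) p ht hp Option.getD) Q R
      = t * condEnt ch (triv p hp) Q R + (1 - t) * condEnt ch (full p hp) Q R := by
  unfold condEnt
  simp only [Fintype.sum_option, out, E_layer, E_triv, E_full, Option.getD_none, Option.getD_some,
    ← Finset.sum_mul, hp.2, one_mul, Finset.mul_sum, Finset.univ_unique, Finset.sum_singleton]
  refine congrArg₂ (· + ·) ?_ ?_
  · refine Finset.sum_congr rfl fun _ _ => Finset.sum_congr rfl fun _ _ =>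
      Finset.sum_congr rfl fun _ _ => ?_
    simp only [layer, triv, eraseLaw]
    ring
  · refine Finset.sum_congr rfl fun _ _ => Finset.sum_congr rfl fun _ _ =>
      Finset.sum_congr rfl fun _ _ => Finset.sum_congr rfl fun _ _ => ?_
    simp only [layer, full, eraseLaw]
    ring

theorem condEnt_erase_mid (ch : 𝒜 → ℬ → 𝒞 → 𝒴 → ℝ) {U W : Type} [Fintype U] [Fintype W]
    {p : ℬ → ℝ} (hp : IsPMF p) {t : ℝ} (ht : IsPMF (eraseLaw t p)) (P : View U 𝒜)
    (R : View W 𝒞) :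
    condEnt ch P (layer (eraseLaw t p) p ht hp Option.getD) R
      = t * condEnt ch P (triv p hp) R + (1 - t) * condEnt ch P (full p hp) R := by
  simp only [← condEnt_swap_left ch, condEnt_erase_left _ hp]

/-- The split in which the first layers of `A` and `B` are copies erased with probabilities
`t` and `s`, and the second layers fill in the erased values. -/
def erasureSplit {pA : 𝒜 → ℝ} {pB : ℬ → ℝ} {pC : 𝒞 → ℝ} (hpA : IsPMF pA) (hpB : IsPMF pB)
    (hpC : IsPMF pC) {s t : ℝ} (ht : IsPMF (eraseLaw t pA)) (hs : IsPMF (eraseLaw s pB)) :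
    MacSplit 𝒜 ℬ 𝒞 where
  A1 := Option 𝒜
  A2 := 𝒜
  B1 := Option ℬ
  B2 := ℬ
  pa1 := eraseLaw t pA
  pa2 := pA
  pb1 := eraseLaw s pB
  pb2 := pB
  pc := pC
  fa := Option.getD
  fb := Option.getD
  pa1_pmf := ht
  pa2_pmf := hpA
  pb1_pmf := hs
  pb2_pmf := hpB
  pc_pmf := hpC

theorem erasureSplit_matches {pA : 𝒜 → ℝ} {pB : ℬ → ℝ} {pC : 𝒞 → ℝ} (hpA : IsPMF pA)
    (hpB : IsPMF pB) (hpC : IsPMF pC) {s t : ℝ} (ht : IsPMF (eraseLaw t pA))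
    (hs : IsPMF (eraseLaw s pB)) : (erasureSplit hpA hpB hpC ht hs).Matches pA pB pC :=
  ⟨pushf_eraseLaw t hpA, pushf_eraseLaw s hpB, rfl⟩

end Erasure

section Inclusions

open View

variable {pA : 𝒜 → ℝ} {pB : ℬ → ℝ} {pC : 𝒞 → ℝ} {ch : 𝒜 → ℬ → 𝒞 → 𝒴 → ℝ}

theorem mem_RMAC_of_mem_split (hpA : IsPMF pA) (hpB : IsPMF pB) (hpC : IsPMF pC)
    (hch0 : ∀ a b c y, 0 ≤ ch a b c y) (hch1 : ∀ a b c, ∑ y, ch a b c y = 1)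
    {s : MacSplit 𝒜 ℬ 𝒞} (hs : s.Matches pA pB pC) {r : ℝ × ℝ × ℝ}
    (hr : r ∈ RMacSplit1 s ch ∪ RMacSplit2 s ch ∪ RMacSplit3 s ch) : r ∈ RMAC pA pB pC ch := by
  have oA : s.viewA.Of pA := layer_of s.pa1_pmf s.pa2_pmf hs.1
  have oB : s.viewB.Of pB := layer_of s.pb1_pmf s.pb2_pmf hs.2.1
  have A₁ := triv_coarser hpA oA
  have A₂ := coarser_full hpA oA
  have B₁ := triv_coarser hpB oB
  have B₂ := coarser_full hpB oB
  have C := triv_coarser hpC (full_of pC hpC)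
  have l {W : Type} [Fintype W] (R : View W 𝒞) := And.intro
    (And.intro (condEnt_submodular_left hch0 R A₁ B₁) (condEnt_submodular_left hch0 R A₁ B₂))
    (And.intro (condEnt_submodular_left hch0 R A₂ B₁) (condEnt_submodular_left hch0 R A₂ B₂))
  have m {V : Type} [Fintype V] (Q : View V ℬ) := And.intro
    (condEnt_submodular_outer hch0 Q A₁ C) (condEnt_submodular_outer hch0 Q A₂ C)
  have n {U : Type} [Fintype U] (P : View U 𝒜) := And.intro
    (condEnt_submodular_right hch0 P B₁ C) (condEnt_submodular_right hch0 P B₂ C)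
  obtain ⟨⟨l₁, l₂⟩, l₃, l₄⟩ := l (triv pC hpC)
  obtain ⟨⟨l₅, l₆⟩, l₇, l₈⟩ := l (full pC hpC)
  obtain ⟨m₁, m₂⟩ := m (triv pB hpB)
  obtain ⟨m₃, m₄⟩ := m s.viewB
  obtain ⟨m₅, m₆⟩ := m (full pB hpB)
  obtain ⟨n₁, n₂⟩ := n (triv pA hpA)
  obtain ⟨n₃, n₄⟩ := n s.viewA
  obtain ⟨n₅, n₆⟩ := n (full pA hpA)
  clear l m n
  rw [mem_RMAC_iff hpA hpB hpC hch1]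
  rcases hr with (hr | hr) | hr
  · rw [mem_RMacSplit1_iff hs hpA hpB hpC hch1] at hr
    obtain ⟨h₁, h₂, h₃, h₄, h₅, h₆⟩ := hr
    refine ⟨h₁, h₂, h₃, ?_, ?_, ?_, ?_, ?_, ?_, ?_⟩ <;> linarith
  · rw [mem_RMacSplit2_iff hs hpA hpB hpC hch1] at hr
    obtain ⟨h₁, h₂, h₃, h₄, h₅, h₆⟩ := hr
    refine ⟨h₁, h₂, h₃, ?_, ?_, ?_, ?_, ?_, ?_, ?_⟩ <;> linarith
  · rw [mem_RMacSplit3_iff hs hpA hpB hpC hch1] at hr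
    obtain ⟨h₁, h₂, h₃, h₄, h₅, h₆⟩ := hr
    refine ⟨h₁, h₂, h₃, ?_, ?_, ?_, ?_, ?_, ?_, ?_⟩ <;> linarith

theorem exists_split_of_mem_RMAC (hpA : IsPMF pA) (hpB : IsPMF pB) (hpC : IsPMF pC)
    (hch0 : ∀ a b c y, 0 ≤ ch a b c y) (hch1 : ∀ a b c, ∑ y, ch a b c y = 1)
    {r : ℝ × ℝ × ℝ} (hr : r ∈ RMAC pA pB pC ch) :
    ∃ s : MacSplit 𝒜 ℬ 𝒞, s.Matches pA pB pC ∧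
      r ∈ RMacSplit1 s ch ∪ RMacSplit2 s ch ∪ RMacSplit3 s ch := by
  have A := triv_coarser hpA (full_of pA hpA)
  have B := triv_coarser hpB (full_of pB hpB)
  have C := triv_coarser hpC (full_of pC hpC)
  have sAB := condEnt_submodular_left hch0 (triv pC hpC) A B
  have sABC := condEnt_submodular_left hch0 (full pC hpC) A B
  have sAC := condEnt_submodular_outer hch0 (triv pB hpB) A C
  have sACB := condEnt_submodular_outer hch0 (full pB hpB) A C
  have sBC := condEnt_submodular_right hch0 (triv pA hpA) B C
  have sBCA := condEnt_submodular_right hch0 (full pA hpA) B C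
  rw [mem_RMAC_iff hpA hpB hpC hch1] at hr
  obtain ⟨p₁, p₂, p₃, h₁, h₂, h₃, h₁₂, h₁₃, h₂₃, h⟩ := hr
  obtain ⟨x, y, z, hx, hy, hz, g₁, g₂, g₃, g₁₂, g₁₃, g₂₃, g⟩ := exists_dominant
    (by linarith) (by linarith) (by linarith) (by linarith) (by linarith) h₁ h₂ h₃ h₁₂ h₁₃ h₂₃ h
  obtain ⟨s, t, s0, s1, t0, t1, H⟩ := exists_erasure_probabilities (by linarith) (by linarith)
    g₁ g₂ g₃ g₁₂ g₁₃ g₂₃ g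
  have ht := eraseLaw_isPMF t0 t1 hpA
  have hs := eraseLaw_isPMF s0 s1 hpB
  have hm := erasureSplit_matches hpA hpB hpC ht hs
  have kA {V W : Type} [Fintype V] [Fintype W] (Q : View V ℬ) (R : View W 𝒞) :
      condEnt ch (erasureSplit hpA hpB hpC ht hs).viewA Q R
        = t * condEnt ch (triv pA hpA) Q R + (1 - t) * condEnt ch (full pA hpA) Q R :=
    condEnt_erase_left ch hpA ht Q R
  have kB {U W : Type} [Fintype U] [Fintype W] (P : View U 𝒜) (R : View W 𝒞) :
      condEnt ch P (erasureSplit hpA hpB hpC ht hs).viewB R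
        = s * condEnt ch P (triv pB hpB) R + (1 - s) * condEnt ch P (full pB hpB) R :=
    condEnt_erase_mid ch hpB hs P R
  refine ⟨erasureSplit hpA hpB hpC ht hs, hm, ?_⟩
  rcases H with ⟨e₁, e₂⟩ | ⟨e₁, e₂⟩ | ⟨e₁, e₂⟩
  · refine Or.inl (Or.inl ((mem_RMacSplit1_iff hm hpA hpB hpC hch1 r).2 ?_))
    simp only [kA, kB]
    refine ⟨p₁, p₂, p₃, ?_, ?_, ?_⟩ <;> linarith
  · refine Or.inl (Or.inr ((mem_RMacSplit2_iff hm hpA hpB hpC hch1 r).2 ?_))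
    simp only [kA, kB]
    refine ⟨p₁, p₂, p₃, ?_, ?_, ?_⟩ <;> linarith
  · refine Or.inr ((mem_RMacSplit3_iff hm hpA hpB hpC hch1 r).2 ?_)
    simp only [kA, kB]
    refine ⟨p₁, p₂, p₃, ?_, ?_, ?_⟩ <;> linarith

end Inclusions

/-- Layer-splitting lemma for a three-user MAC:
`𝓡_MAC(A,B,C;Y) = ⋃_{p' ≃ p} ⋃_{λ=1}^{3} 𝓡(p',λ)`. -/
theorem mac_layer_splitting
    (pA : 𝒜 → ℝ) (pB : ℬ → ℝ) (pC : 𝒞 → ℝ) (ch : 𝒜 → ℬ → 𝒞 → 𝒴 → ℝ)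
    (hpA : IsPMF pA) (hpB : IsPMF pB) (hpC : IsPMF pC)
    (hch0 : ∀ a b c y, 0 ≤ ch a b c y) (hch1 : ∀ a b c, ∑ y, ch a b c y = 1) :
    RMAC pA pB pC ch
      = ⋃ (s : MacSplit 𝒜 ℬ 𝒞) (_ : s.Matches pA pB pC),
          (RMacSplit1 s ch ∪ RMacSplit2 s ch ∪ RMacSplit3 s ch) := by
  ext r
  simp only [Set.mem_iUnion, exists_prop]
  exact ⟨exists_split_of_mem_RMAC hpA hpB hpC hch0 hch1,
    fun ⟨_, hs, hr⟩ => mem_RMAC_of_mem_split hpA hpB hpC hch0 hch1 hs hr⟩
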